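/- arXiv:2401.13523 — 13 statements merged into one kernel-verified Lean document; each statement's English description precedes it below -/
import Mathlib

section
/- Let G be a finite group and T a G-transfer system. If subgroups A and B of G lie in the same connected component of T, then there is a subgroup L of G such that T contains both the edge L → A and the edge L → B (equivalently, A and B are joined by an undirected path in T of length at most two of the form A ← L → B). -/
/-- A `G`-transfer system: a relation on subgroups of `G` satisfying the subgroup,
reflexivity, transitivity, restriction, and conjugation conditions. -/
def IsTransferSystem {G : Type*} [Group G] (T : Subgroup G → Subgroup G → Prop) : Prop :=
  (∀ K H, T K H → K ≤ H) ∧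
  (∀ H, T H H) ∧
  (∀ L K H, T L K → T K H → T L H) ∧
  (∀ K H L, T K H → T (K ⊓ L) (H ⊓ L)) ∧
  (∀ K H (g : G), T K H →
    T (Subgroup.map (MulAut.conj g).toMonoidHom K) (Subgroup.map (MulAut.conj g).toMonoidHom H))

/-- Two subgroups are in the same connected component of `T` if they are related by
the reflexive-transitive closure of the symmetrization of `T`. -/
def SameComponent {G : Type*} [Group G] (T : Subgroup G → Subgroup G → Prop)
    (A B : Subgroup G) : Prop :=
  Relation.ReflTransGen (fun X Y => T X Y ∨ T Y X) A B

/-- If subgroups `A` and `B` lie in the same connected component of a `G`-transfer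
system `T`, then there is a subgroup `L` with edges `L → A` and `L → B` in `T`. -/
theorem zigzag_length_two {G : Type*} [Group G] [Finite G]
    (T : Subgroup G → Subgroup G → Prop) (hT : IsTransferSystem T)
    (A B : Subgroup G) (h : SameComponent T A B) :
    ∃ L : Subgroup G, T L A ∧ T L B := by
  obtain ⟨hle, hrefl, htrans, hres, -⟩ := hT
  induction h with
  | refl => exact ⟨A, hrefl A, hrefl A⟩
  | @tail B C _ hBC ih =>
    obtain ⟨L, hLA, hLB⟩ := ih
    rcases hBC with hBC | hCB
    · exact ⟨L, hLA, htrans _ _ _ hLB hBC⟩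
    · refine ⟨L ⊓ C, htrans _ L _ ?_ hLA, ?_⟩
      · simpa only [inf_comm C L, inf_eq_right.mpr (hle _ _ hLB)] using hres _ _ L hCB
      · simpa only [inf_eq_right.mpr (hle _ _ hCB)] using hres _ _ C hLB
end

section
/- Let G be a finite group, T a G-transfer system, and T_h a saturated hull of T (i.e. T_h is a saturated G-transfer system containing T that is contained in every saturated G-transfer system containing T). Then two subgroups of G are in the same connected component of T if and only if they are in the same connected component of T_h. -/
/-- A transfer system is saturated if `L ≤ K ≤ H` and `T L H` imply `T K H`. -/
def IsSaturated {G : Type*} [Group G] (T : Subgroup G → Subgroup G → Prop) : Prop :=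
  ∀ L K H : Subgroup G, L ≤ K → K ≤ H → T L H → T K H

/-- `Th` is a saturated hull of `T`: a saturated transfer system containing `T`
that is contained in every saturated transfer system containing `T`. -/
def IsSaturatedHull {G : Type*} [Group G] (T Th : Subgroup G → Subgroup G → Prop) : Prop :=
  IsTransferSystem Th ∧ IsSaturated Th ∧ (∀ K H, T K H → Th K H) ∧
  ∀ T'' : Subgroup G → Subgroup G → Prop, IsTransferSystem T'' → IsSaturated T'' →
    (∀ K H, T K H → T'' K H) → (∀ K H, Th K H → T'' K H)

/-- The saturation of `T`: an inclusion `K ≤ H` is admissible when `T M H` for some `M ≤ K`. -/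
def Saturation {G : Type*} [Group G] (T : Subgroup G → Subgroup G → Prop)
    (K H : Subgroup G) : Prop :=
  K ≤ H ∧ ∃ M, M ≤ K ∧ T M H

theorem isTransferSystem_saturation {G : Type*} [Group G] {T : Subgroup G → Subgroup G → Prop}
    (hT : IsTransferSystem T) : IsTransferSystem (Saturation T) := by
  obtain ⟨-, hrefl, htrans, hres, hconj⟩ := hT
  refine ⟨fun K H h => h.1, fun H => ⟨le_rfl, H, le_rfl, hrefl H⟩, ?_, ?_, ?_⟩
  · rintro L K H ⟨hLK, N, hNL, hNK⟩ ⟨hKH, M, hMK, hMH⟩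
    refine ⟨hLK.trans hKH, N ⊓ M, inf_le_left.trans hNL, htrans _ M _ ?_ hMH⟩
    simpa only [inf_eq_right.mpr hMK] using hres N K M hNK
  · rintro K H L ⟨hKH, M, hMK, hMH⟩
    exact ⟨inf_le_inf_right L hKH, M ⊓ L, inf_le_inf_right L hMK, hres M H L hMH⟩
  · rintro K H g ⟨hKH, M, hMK, hMH⟩
    exact ⟨Subgroup.map_mono hKH, _, Subgroup.map_mono hMK, hconj M H g hMH⟩

theorem isSaturated_saturation {G : Type*} [Group G] (T : Subgroup G → Subgroup G → Prop) :
    IsSaturated (Saturation T) := by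
  rintro L K H hLK hKH ⟨-, M, hML, hMH⟩
  exact ⟨hKH, M, hML.trans hLK, hMH⟩

/-- Both ends of a relation in the saturation restrict to a common source in `T`. -/
theorem Saturation.exists_common_source {G : Type*} [Group G]
    {T : Subgroup G → Subgroup G → Prop} (hT : IsTransferSystem T) {K H : Subgroup G}
    (h : Saturation T K H) : ∃ M, T M K ∧ T M H := by
  obtain ⟨hKH, M, hMK, hMH⟩ := h
  refine ⟨M, ?_, hMH⟩
  simpa only [inf_eq_left.mpr hMK, inf_eq_right.mpr hKH] using hT.2.2.2.1 M H K hMH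

/-- Two subgroups are in the same connected component of `T` iff they are in the
same connected component of a saturated hull of `T`. -/
theorem sameComponent_hull_iff {G : Type*} [Group G] [Finite G]
    (T Th : Subgroup G → Subgroup G → Prop) (hT : IsTransferSystem T)
    (hTh : IsSaturatedHull T Th) (A B : Subgroup G) :
    SameComponent T A B ↔ SameComponent Th A B := by
  obtain ⟨-, -, hle, hmin⟩ := hTh
  have hsat := hmin (Saturation T) (isTransferSystem_saturation hT) (isSaturated_saturation T)
    fun K H h => ⟨hT.1 K H h, K, le_rfl, h⟩
  constructor
  · exact Relation.ReflTransGen.mono (fun X Y => Or.imp (hle X Y) (hle Y X)) A B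
  · intro h
    refine Relation.reflTransGen_closed ?_ _ _ h
    rintro X Y (hXY | hYX)
    · obtain ⟨M, hX, hY⟩ := (hsat X Y hXY).exists_common_source hT
      exact (Relation.ReflTransGen.single (.inr hX)).tail (.inl hY)
    · obtain ⟨M, hY, hX⟩ := (hsat Y X hYX).exists_common_source hT
      exact (Relation.ReflTransGen.single (.inr hX)).tail (.inl hY)
end

section
/- Let G be a finite group and let T and T' be G-transfer systems with T contained in T'. If T' is saturated, then (T, T') is a compatible pair. -/
/-- `(T, T')` is a compatible pair of transfer systems. -/
def Compatible {G : Type*} [Group G] (T T' : Subgroup G → Subgroup G → Prop) : Prop :=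
  (∀ K H, T K H → T' K H) ∧
  ∀ A B C : Subgroup G, B ≤ A → C ≤ A → T B A → T' (B ⊓ C) B → T' C A

/-- If `T'` is a saturated transfer system containing `T`, then `(T, T')` is a
compatible pair. -/
theorem compatible_of_saturated {G : Type*} [Group G] [Finite G]
    (T T' : Subgroup G → Subgroup G → Prop) (hT : IsTransferSystem T)
    (hT' : IsTransferSystem T') (hsub : ∀ K H, T K H → T' K H)
    (hsat : IsSaturated T') :
    Compatible T T' := by
  exact ⟨hsub, fun A B C _ hCA hBA hBC =>
    hsat (B ⊓ C) C A inf_le_right hCA (hT'.2.2.1 _ _ _ hBC (hsub _ _ hBA))⟩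
end

section
/- Let G be a finite group and T a G-transfer system. Then (T, T_c) is a compatible pair, where T_c is the complete transfer system; and if T_h is a saturated hull of T (a saturated G-transfer system containing T contained in every saturated G-transfer system containing T), then (T, T_h) is a compatible pair. -/
/-- `(T, T_c)` is a compatible pair, and `(T, Th)` is a compatible pair for any
saturated hull `Th` of `T`. -/
theorem compatible_complete_and_hull {G : Type*} [Group G] [Finite G]
    (T : Subgroup G → Subgroup G → Prop) (hT : IsTransferSystem T) :
    Compatible T (fun K H => K ≤ H) ∧
    ∀ Th : Subgroup G → Subgroup G → Prop, IsSaturatedHull T Th → Compatible T Th := by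
  refine ⟨⟨hT.1, fun _ _ _ _ hCA _ _ => hCA⟩, ?_⟩
  rintro Th ⟨hTh, hsat, hsub, -⟩
  exact ⟨hsub, fun A B C _ hCA hBA hBC =>
    hsat (B ⊓ C) C A inf_le_right hCA (hTh.2.2.1 _ _ _ hBC (hsub _ _ hBA))⟩
end

section
/- Let G be a finite group and let T and T' be G-transfer systems such that (T, T') is a compatible pair. Then T' contains every saturated hull of T; more precisely, if T_h is a saturated G-transfer system containing T that is contained in every saturated G-transfer system containing T, then T_h is contained in T'. In particular, T' is saturated on the edges forced by T: whenever L ≤ K ≤ H and T L H and T L K hold, T' contains K → H. -/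
/-- The edges `B → A` along which `T'` can be lifted: for all `C ≤ M ≤ A`, the relation
`T' (B ⊓ C) (B ⊓ M)` forces `T' C M`. -/
def LiftEdge {G : Type*} [Group G] (T' : Subgroup G → Subgroup G → Prop)
    (B A : Subgroup G) : Prop :=
  B ≤ A ∧ ∀ C M : Subgroup G, C ≤ M → M ≤ A → T' (B ⊓ C) (B ⊓ M) → T' C M

theorem LiftEdge.rel {G : Type*} [Group G] {T' : Subgroup G → Subgroup G → Prop}
    (hT' : IsTransferSystem T') {B A : Subgroup G} (h : LiftEdge T' B A) : T' B A := by
  refine h.2 B A h.1 le_rfl ?_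
  rw [inf_idem, inf_eq_left.2 h.1]
  exact hT'.2.1 B

theorem isSaturated_liftEdge {G : Type*} [Group G] {T' : Subgroup G → Subgroup G → Prop}
    (hT' : IsTransferSystem T') : IsSaturated (LiftEdge T') := by
  intro L K H hLK hKH h
  refine ⟨hKH, fun C M hCM hM hr => h.2 C M hCM hM ?_⟩
  have hL := hT'.2.2.2.1 _ _ L hr
  rwa [inf_right_comm, inf_right_comm K M, inf_eq_right.2 hLK] at hL

theorem Subgroup.map_conj_inv_map_conj {G : Type*} [Group G] (g : G) (K : Subgroup G) :
    (K.map (MulAut.conj g).toMonoidHom).map (MulAut.conj g⁻¹).toMonoidHom = K := by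
  rw [Subgroup.map_map]
  convert K.map_id
  ext x
  simp [mul_assoc]

theorem Subgroup.map_conj_map_conj_inv {G : Type*} [Group G] (g : G) (K : Subgroup G) :
    (K.map (MulAut.conj g⁻¹).toMonoidHom).map (MulAut.conj g).toMonoidHom = K := by
  simpa using K.map_conj_inv_map_conj g⁻¹

theorem isTransferSystem_liftEdge {G : Type*} [Group G]
    {T' : Subgroup G → Subgroup G → Prop} (hT' : IsTransferSystem T') :
    IsTransferSystem (LiftEdge T') := by
  refine ⟨fun K H h => h.1, fun H => ⟨le_rfl, fun C M hCM hM hr => ?_⟩,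
    fun L K H hLK hKH => ⟨hLK.1.trans hKH.1, fun C M hCM hM hr => ?_⟩,
    fun K H L h => ⟨inf_le_inf_right L h.1, fun C M hCM hM hr => ?_⟩,
    fun K H g h => ⟨Subgroup.map_mono h.1, fun C M hCM hM hr => ?_⟩⟩
  · rwa [inf_eq_right.2 hM, inf_eq_right.2 (hCM.trans hM)] at hr
  · refine hKH.2 C M hCM hM (hLK.2 _ _ (inf_le_inf_left K hCM) inf_le_left ?_)
    rwa [← inf_assoc, ← inf_assoc, inf_eq_left.2 hLK.1]
  · refine h.2 C M hCM (hM.trans inf_le_left) ?_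
    have hML : M ≤ L := hM.trans inf_le_right
    rwa [inf_assoc, inf_assoc, inf_eq_right.2 hML, inf_eq_right.2 (hCM.trans hML)] at hr
  · have hinj : Function.Injective (MulAut.conj g⁻¹).toMonoidHom := (MulAut.conj g⁻¹).injective
    have hr' := hT'.2.2.2.2 _ _ g⁻¹ hr
    rw [Subgroup.map_inf _ _ _ hinj, Subgroup.map_inf _ _ _ hinj,
      Subgroup.map_conj_inv_map_conj] at hr'
    have hM' := Subgroup.map_mono (f := (MulAut.conj g⁻¹).toMonoidHom) hM
    rw [Subgroup.map_conj_inv_map_conj] at hM'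
    have hCM' := hT'.2.2.2.2 _ _ g (h.2 _ _ (Subgroup.map_mono hCM) hM' hr')
    rwa [Subgroup.map_conj_map_conj_inv, Subgroup.map_conj_map_conj_inv] at hCM'

theorem Compatible.liftEdge {G : Type*} [Group G] {T T' : Subgroup G → Subgroup G → Prop}
    (hcomp : Compatible T T') (hT : IsTransferSystem T) {B A : Subgroup G} (h : T B A) :
    LiftEdge T' B A := by
  refine ⟨hT.1 B A h, fun C M hCM hM hr => hcomp.2 M (B ⊓ M) C inf_le_right hCM ?_ ?_⟩
  · have hBM := hT.2.2.2.1 B A M h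
    rwa [inf_eq_right.2 hM] at hBM
  · rwa [inf_assoc, inf_eq_right.2 hCM]

/-- If `(T, T')` is a compatible pair, then `T'` contains every saturated hull of
`T`; in particular `T'` contains the edges forced by saturation on `T`. -/
theorem compatible_contains_hull {G : Type*} [Group G] [Finite G]
    (T T' : Subgroup G → Subgroup G → Prop) (hT : IsTransferSystem T)
    (hT' : IsTransferSystem T') (hcomp : Compatible T T') :
    (∀ Th : Subgroup G → Subgroup G → Prop, IsSaturatedHull T Th →
      ∀ K H, Th K H → T' K H) ∧
    (∀ L K H : Subgroup G, L ≤ K → K ≤ H → T L H → T L K → T' K H) := by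
  refine ⟨fun Th hTh K H h => ?_, fun L K H hLK hKH hLH _ => ?_⟩
  · exact (hTh.2.2.2 (LiftEdge T') (isTransferSystem_liftEdge hT') (isSaturated_liftEdge hT')
      (fun _ _ => hcomp.liftEdge hT) K H h).rel hT'
  · exact (isSaturated_liftEdge hT' L K H hLK hKH (hcomp.liftEdge hT hLH)).rel hT'
end

section
/- Let G be a finite group, T a G-transfer system, and S a set of subgroups of G (thought of as a set of edges e → H from the trivial subgroup e to each H in S). Then there exists a G-transfer system T' such that: T is contained in T'; T' contains the edge e → H for every H in S; (T, T') is a compatible pair; and T' is contained in every G-transfer system T'' that contains T, contains the edge e → H for every H in S, and forms a compatible pair (T, T''). -/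
/-- The inclusion relation is a transfer system. -/
theorem isTransferSystem_le {G : Type*} [Group G] :
    IsTransferSystem (fun K H : Subgroup G => K ≤ H) :=
  ⟨fun _ _ h => h, fun _ => le_rfl, fun _ _ _ => le_trans,
    fun _ _ L h => inf_le_inf_right L h, fun _ _ _ h => Subgroup.map_mono h⟩

/-- The intersection of a nonempty family of transfer systems is a transfer system. -/
theorem IsTransferSystem.sInter {G : Type*} [Group G]
    {P : (Subgroup G → Subgroup G → Prop) → Prop} (hne : ∃ R, P R)
    (hP : ∀ R, P R → IsTransferSystem R) :
    IsTransferSystem (fun K H => ∀ R, P R → R K H) := by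
  obtain ⟨R₀, hR₀⟩ := hne
  refine ⟨fun K H h => (hP R₀ hR₀).1 K H (h R₀ hR₀), fun H R hR => (hP R hR).2.1 H,
    fun L K H h₁ h₂ R hR => (hP R hR).2.2.1 L K H (h₁ R hR) (h₂ R hR),
    fun K H L h R hR => (hP R hR).2.2.2.1 K H L (h R hR),
    fun K H g h R hR => (hP R hR).2.2.2.2 K H g (h R hR)⟩

/-- Compatibility with `T` is preserved by intersections. -/
theorem Compatible.sInter {G : Type*} [Group G] {T : Subgroup G → Subgroup G → Prop}
    {P : (Subgroup G → Subgroup G → Prop) → Prop} (hP : ∀ R, P R → Compatible T R) :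
    Compatible T (fun K H => ∀ R, P R → R K H) :=
  ⟨fun K H h R hR => (hP R hR).1 K H h,
    fun A B C hB hC hT h R hR => (hP R hR).2 A B C hB hC hT (h R hR)⟩

/-- Given a transfer system `T` and a set `S` of subgroups (edges `e → H` for `H ∈ S`),
there exists a smallest transfer system `T'` containing `T` and the edges `⊥ → H` for
`H ∈ S` such that `(T, T')` is a compatible pair. -/
theorem exists_smallest_compatible {G : Type*} [Group G] [Finite G]
    (T : Subgroup G → Subgroup G → Prop) (hT : IsTransferSystem T)
    (S : Set (Subgroup G)) :
    ∃ T' : Subgroup G → Subgroup G → Prop,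
      IsTransferSystem T' ∧
      (∀ K H, T K H → T' K H) ∧
      (∀ H ∈ S, T' ⊥ H) ∧
      Compatible T T' ∧
      ∀ T'' : Subgroup G → Subgroup G → Prop, IsTransferSystem T'' →
        (∀ K H, T K H → T'' K H) → (∀ H ∈ S, T'' ⊥ H) → Compatible T T'' →
        ∀ K H, T' K H → T'' K H := by
  let P : (Subgroup G → Subgroup G → Prop) → Prop := fun R =>
    IsTransferSystem R ∧ (∀ H ∈ S, R ⊥ H) ∧ Compatible T R
  have hle : P (fun K H => K ≤ H) :=
    ⟨isTransferSystem_le, fun _ _ => bot_le, hT.1, fun _ _ _ _ hC _ _ => hC⟩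
  have hcomp : Compatible T (fun K H => ∀ R, P R → R K H) :=
    Compatible.sInter fun _ hR => hR.2.2
  exact ⟨fun K H => ∀ R, P R → R K H, IsTransferSystem.sInter ⟨_, hle⟩ fun _ hR => hR.1,
    hcomp.1, fun H hH _ hR => hR.2.1 H hH, hcomp,
    fun R hR _ hS hc _ _ h => h R ⟨hR, hS, hc⟩⟩
end

section
/- Let G be a finite group and T a G-transfer system that is connected (every two subgroups of G lie in the same connected component of T). Then T is lesser simply paired; moreover, in this case the only G-transfer system T' containing T for which (T, T') is a compatible pair is the complete transfer system T_c. -/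
/-- `T` is lesser simply paired: for all transfer systems `T'` containing `T`,
`(T, T')` is compatible iff `T'` is a saturated hull of `T` or `T'` is complete. -/
def LesserSimplyPaired {G : Type*} [Group G] (T : Subgroup G → Subgroup G → Prop) : Prop :=
  ∀ T' : Subgroup G → Subgroup G → Prop, IsTransferSystem T' → (∀ K H, T K H → T' K H) →
    (Compatible T T' ↔ (IsSaturatedHull T T' ∨ T' = fun K H => K ≤ H))

/-- Two subgroups in the same component of a transfer system have a common lower bound
with respect to it. -/
theorem SameComponent.exists_common_lower {G : Type*} [Group G]
    {T : Subgroup G → Subgroup G → Prop} (hT : IsTransferSystem T) {A B : Subgroup G}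
    (h : SameComponent T A B) : ∃ X, T X A ∧ T X B := by
  obtain ⟨hle, hrefl, htrans, hres, -⟩ := hT
  induction h with
  | refl => exact ⟨A, hrefl A, hrefl A⟩
  | @tail B C _ hBC ih =>
    obtain ⟨X, hXA, hXB⟩ := ih
    rcases hBC with hBC | hCB
    · exact ⟨X, hXA, htrans _ _ _ hXB hBC⟩
    · have h₁ := hres X B C hXB
      have h₂ := hres C B X hCB
      rw [inf_eq_right.mpr (hle _ _ hCB)] at h₁
      rw [inf_eq_right.mpr (hle _ _ hXB), inf_comm] at h₂
      exact ⟨X ⊓ C, htrans _ _ _ h₂ hXA, h₁⟩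

/-- In a connected transfer system the trivial subgroup is related to every subgroup. -/
theorem IsTransferSystem.bot_left_of_connected {G : Type*} [Group G]
    {T : Subgroup G → Subgroup G → Prop} (hT : IsTransferSystem T)
    (hconn : ∀ A B : Subgroup G, SameComponent T A B) (H : Subgroup G) : T ⊥ H := by
  obtain ⟨X, hX, hXH⟩ := (hconn ⊥ H).exists_common_lower hT
  rwa [le_bot_iff.mp (hT.1 _ _ hX)] at hXH

/-- A connected transfer system is lesser simply paired; moreover the only transfer
system containing it with which it is compatible is the complete one. -/
theorem connected_lsp {G : Type*} [Group G] [Finite G]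
    (T : Subgroup G → Subgroup G → Prop) (hT : IsTransferSystem T)
    (hconn : ∀ A B : Subgroup G, SameComponent T A B) :
    LesserSimplyPaired T ∧
    ∀ T' : Subgroup G → Subgroup G → Prop, IsTransferSystem T' →
      (∀ K H, T K H → T' K H) → Compatible T T' → T' = fun K H => K ≤ H := by
  have hbot := hT.bot_left_of_connected hconn
  have hcomplete : ∀ T' : Subgroup G → Subgroup G → Prop, IsTransferSystem T' →
      (∀ K H, T K H → T' K H) → Compatible T T' → T' = fun K H => K ≤ H := by
    intro T' hT' _ hc
    funext K H
    refine propext ⟨hT'.1 K H, fun hKH => hc.2 H ⊥ K bot_le hKH (hbot H) ?_⟩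
    rw [bot_inf_eq]
    exact hT'.2.1 ⊥
  refine ⟨fun T' hT' hsub => ⟨fun hc => Or.inr (hcomplete T' hT' hsub hc), fun h => ?_⟩, hcomplete⟩
  have hle : ∀ K H, K ≤ H → T' K H := by
    rcases h with ⟨-, hsat, -⟩ | rfl
    · exact fun K H hKH => hsat ⊥ K H bot_le hKH (hsub _ _ (hbot H))
    · exact fun _ _ h => h
  exact ⟨hsub, fun A _ C _ hCA _ _ => hle C A hCA⟩
end

section
/- Let T be a C_{p^r q^s}-transfer system, modeled on the grid Fin (r+1) × Fin (s+1), and let (a,b) be the lexicographically smallest vertex of its connected component in T, where (a,b) <_L (c,d) iff a < c, or a = c and b < d. Then for every vertex (x,y) in the connected component of (a,b), one has a ≤ x and b ≤ y. -/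
/-- A `C_{p^r q^s}`-transfer system, modeled on the grid `Fin (r+1) × Fin (s+1)`
with the componentwise order and componentwise minimum `⊓`. -/
def IsGridTransferSystem {r s : ℕ}
    (T : Fin (r+1) × Fin (s+1) → Fin (r+1) × Fin (s+1) → Prop) : Prop :=
  (∀ v w, T v w → v ≤ w) ∧
  (∀ v, T v v) ∧
  (∀ u v w, T u v → T v w → T u w) ∧
  (∀ v w u, T v w → T (v ⊓ u) (w ⊓ u))

/-- Two vertices are in the same connected component of `T` if they are related by
the reflexive-transitive closure of the symmetrization of `T`. -/
def GridSameComponent {r s : ℕ}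
    (T : Fin (r+1) × Fin (s+1) → Fin (r+1) × Fin (s+1) → Prop)
    (v w : Fin (r+1) × Fin (s+1)) : Prop :=
  Relation.ReflTransGen (fun x y => T x y ∨ T y x) v w

/-- Restriction along any `u` maps connected components into connected components. -/
theorem GridSameComponent.inf_right {r s : ℕ}
    {T : Fin (r+1) × Fin (s+1) → Fin (r+1) × Fin (s+1) → Prop}
    (hT : IsGridTransferSystem T) {v w : Fin (r+1) × Fin (s+1)}
    (h : GridSameComponent T v w) (u : Fin (r+1) × Fin (s+1)) :
    GridSameComponent T (v ⊓ u) (w ⊓ u) :=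
  Relation.ReflTransGen.lift (· ⊓ u)
    (fun _ _ => Or.imp (hT.2.2.2 _ _ u) (hT.2.2.2 _ _ u)) _ _ h

/-- If `m` is the lexicographically smallest vertex of its connected component in a
grid transfer system `T`, then `m` is coordinatewise below every vertex of its
component. -/
theorem lex_smallest_is_smallest {r s : ℕ}
    (T : Fin (r+1) × Fin (s+1) → Fin (r+1) × Fin (s+1) → Prop)
    (hT : IsGridTransferSystem T) (m : Fin (r+1) × Fin (s+1))
    (hmin : ∀ v, GridSameComponent T m v →
      m.1 < v.1 ∨ (m.1 = v.1 ∧ m.2 ≤ v.2)) :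
    ∀ v, GridSameComponent T m v → m.1 ≤ v.1 ∧ m.2 ≤ v.2 := by
  intro v hv
  have hle : m.1 ≤ v.1 := (hmin v hv).elim le_of_lt fun h => h.1.le
  have hm : m ⊓ (m.1, ⊤) = m := by ext <;> simp
  have hv' : v ⊓ (m.1, ⊤) = (m.1, v.2) := by ext <;> simp [hle]
  have h := hv.inf_right hT (m.1, ⊤)
  rw [hm, hv'] at h
  exact ⟨hle, (hmin _ h).elim (fun hlt => absurd hlt (lt_irrefl _)) fun h => h.2⟩
end

section
/- Let T be a C_{p^r q^s}-transfer system, modeled on the grid Fin (r+1) × Fin (s+1). Then the connected component of the top vertex (r,s) in T is a rectangle: there exists a vertex (a,b) such that the connected component of (r,s) equals the set of all vertices (i,j) with a ≤ i and b ≤ j. -/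
namespace IsGridTransferSystem

variable {r s : ℕ} {T : Fin (r+1) × Fin (s+1) → Fin (r+1) × Fin (s+1) → Prop}

/-- Connectedness in a transfer system is preserved by meeting with a fixed vertex. -/
theorem sameComponent_inf (hT : IsGridTransferSystem T) {v w : Fin (r+1) × Fin (s+1)}
    (h : GridSameComponent T v w) (u : Fin (r+1) × Fin (s+1)) :
    GridSameComponent T (v ⊓ u) (w ⊓ u) := by
  induction h with
  | refl => exact Relation.ReflTransGen.refl
  | tail _ hxy ih => exact ih.tail (hxy.imp (hT.2.2.2 _ _ u) (hT.2.2.2 _ _ u))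

/-- If `v` lies in the component of the top vertex, every `u` is connected to `v ⊓ u`. -/
theorem sameComponent_inf_of_top (hT : IsGridTransferSystem T) {v : Fin (r+1) × Fin (s+1)}
    (h : GridSameComponent T (Fin.last r, Fin.last s) v) (u : Fin (r+1) × Fin (s+1)) :
    GridSameComponent T u (v ⊓ u) := by
  have hu : (Fin.last r, Fin.last s) ⊓ u = u :=
    inf_eq_right.2 ⟨Fin.le_last _, Fin.le_last _⟩
  simpa only [hu] using hT.sameComponent_inf h u

end IsGridTransferSystem

theorem GridSameComponent.symm {r s : ℕ}
    {T : Fin (r+1) × Fin (s+1) → Fin (r+1) × Fin (s+1) → Prop}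
    {v w : Fin (r+1) × Fin (s+1)} (h : GridSameComponent T v w) : GridSameComponent T w v := by
  induction h with
  | refl => exact Relation.ReflTransGen.refl
  | tail _ hxy ih => exact ih.head hxy.symm

/-- The connected component of the top vertex `(r,s)` of a grid transfer system is a
rectangle: it is the set of vertices coordinatewise above some vertex `(a,b)`. -/
theorem top_component_is_rectangle {r s : ℕ}
    (T : Fin (r+1) × Fin (s+1) → Fin (r+1) × Fin (s+1) → Prop)
    (hT : IsGridTransferSystem T) :
    ∃ a : Fin (r+1) × Fin (s+1),
      ∀ v, GridSameComponent T (Fin.last r, Fin.last s) v ↔ a ≤ v := by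
  obtain ⟨a, ha⟩ := (Set.toFinite
    {v | GridSameComponent T (Fin.last r, Fin.last s) v}).exists_minimal
    ⟨_, Relation.ReflTransGen.refl⟩
  refine ⟨a, fun v => ⟨fun hv => ?_, fun hav => ?_⟩⟩
  · have hmem : GridSameComponent T (Fin.last r, Fin.last s) (a ⊓ v) :=
      Relation.ReflTransGen.trans hv (hT.sameComponent_inf_of_top ha.prop v)
    exact (ha.le_of_le hmem inf_le_left).trans inf_le_right
  · have hva := hT.sameComponent_inf_of_top ha.prop v
    rw [inf_eq_left.2 hav] at hva
    exact Relation.ReflTransGen.trans ha.prop hva.symm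
end

section
/- Let T be a C_{p^r q^s}-transfer system, modeled on the grid Fin (r+1) × Fin (s+1), let (x,y) be a vertex, and let (a,b) be the lexicographically smallest vertex of the connected component of (x,y) in T, where (a,b) <_L (c,d) iff a < c, or a = c and b < d. Then T contains the edge (a,b) → (x,y). -/
/-- If `m` is the lexicographically smallest vertex of the connected component of `v`
in a grid transfer system `T`, then `T` contains the edge `m → v`. -/
theorem edge_from_smallest {r s : ℕ}
    (T : Fin (r+1) × Fin (s+1) → Fin (r+1) × Fin (s+1) → Prop)
    (hT : IsGridTransferSystem T) (m v : Fin (r+1) × Fin (s+1))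
    (hmv : GridSameComponent T m v)
    (hmin : ∀ w, GridSameComponent T m w →
      m.1 < w.1 ∨ (m.1 = w.1 ∧ m.2 ≤ w.2)) :
    T m v := by
  obtain ⟨le, refl, trans, restr⟩ := hT
  induction hmv with
  | refl => exact refl m
  | @tail u w hmu huw ih =>
    rcases huw with huw | hwu
    · exact trans _ _ _ ih huw
    · have hmw : T (m ⊓ w) w := by
        simpa only [inf_eq_right.mpr (le _ _ hwu)] using restr _ _ w ih
      have hcomp : GridSameComponent T m (m ⊓ w) :=
        (hmu.tail (Or.inr hwu)).tail (Or.inr hmw)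
      have hm : m ≤ w := by
        rcases hmin _ hcomp with h | ⟨h₁, h₂⟩
        · exact absurd h (not_lt.mpr inf_le_left)
        · exact ⟨h₁.le.trans inf_le_right, h₂.trans inf_le_right⟩
      rwa [inf_eq_left.mpr hm] at hmw
end

section
/- Let T be a C_{p^r q^s}-transfer system, modeled on the grid Fin (r+1) × Fin (s+1), with exactly two connected components. If the connected component of (0,0) equals H_k = {(i,j) : j ≤ k} for some k with 0 < k < s, or equals V_ℓ = {(i,j) : i ≤ ℓ} for some ℓ with 0 < ℓ < r, then T is not lesser simply paired. -/
/-- `(T, T')` is a compatible pair of grid transfer systems. -/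
def GridCompatible {r s : ℕ}
    (T T' : Fin (r+1) × Fin (s+1) → Fin (r+1) × Fin (s+1) → Prop) : Prop :=
  (∀ v w, T v w → T' v w) ∧
  ∀ A B C : Fin (r+1) × Fin (s+1), B ≤ A → C ≤ A → T B A → T' (B ⊓ C) B → T' C A

/-- A grid transfer system is saturated if `u ≤ v ≤ w` and `T u w` imply `T v w`. -/
def GridSaturated {r s : ℕ}
    (T : Fin (r+1) × Fin (s+1) → Fin (r+1) × Fin (s+1) → Prop) : Prop :=
  ∀ u v w : Fin (r+1) × Fin (s+1), u ≤ v → v ≤ w → T u w → T v w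

/-- `Th` is a saturated hull of `T`. -/
def GridSaturatedHull {r s : ℕ}
    (T Th : Fin (r+1) × Fin (s+1) → Fin (r+1) × Fin (s+1) → Prop) : Prop :=
  IsGridTransferSystem Th ∧ GridSaturated Th ∧ (∀ v w, T v w → Th v w) ∧
  ∀ T'' : Fin (r+1) × Fin (s+1) → Fin (r+1) × Fin (s+1) → Prop,
    IsGridTransferSystem T'' → GridSaturated T'' →
    (∀ v w, T v w → T'' v w) → (∀ v w, Th v w → T'' v w)

/-- `T` is lesser simply paired. -/
def GridLesserSimplyPaired {r s : ℕ}
    (T : Fin (r+1) × Fin (s+1) → Fin (r+1) × Fin (s+1) → Prop) : Prop :=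
  ∀ T' : Fin (r+1) × Fin (s+1) → Fin (r+1) × Fin (s+1) → Prop,
    IsGridTransferSystem T' → (∀ v w, T v w → T' v w) →
    (GridCompatible T T' ↔ (GridSaturatedHull T T' ∨ T' = fun v w => v ≤ w))

/-- `T` has exactly two connected components: `(0,0)` and `(r,s)` are in different
components and every vertex is in the component of one of them. -/
def GridTwoComponents {r s : ℕ}
    (T : Fin (r+1) × Fin (s+1) → Fin (r+1) × Fin (s+1) → Prop) : Prop :=
  ¬ GridSameComponent T (0, 0) (Fin.last r, Fin.last s) ∧
  ∀ v, GridSameComponent T (0, 0) v ∨ GridSameComponent T (Fin.last r, Fin.last s) v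

/-- Suppose a meet-preserving height function `π` takes values at most `k` and values exceeding `k`,
with a positive value at most `k`, along a chain. If every relation of `T` stays on one side of the
threshold `k`, then adjoining all relations out of height `0` gives a compatible transfer system
that is neither complete nor a saturated hull. -/
theorem not_gridLesserSimplyPaired_of_threshold {r s : ℕ}
    (T : Fin (r+1) × Fin (s+1) → Fin (r+1) × Fin (s+1) → Prop) (hT : IsGridTransferSystem T)
    (π : Fin (r+1) × Fin (s+1) → ℕ) (hπ : ∀ v w, π (v ⊓ w) = min (π v) (π w)) (k : ℕ)
    (hside : ∀ v w, T v w → (π v ≤ k ↔ π w ≤ k))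
    (a b c : Fin (r+1) × Fin (s+1)) (hab : a ≤ b) (hbc : b ≤ c)
    (ha : π a = 0) (hb : 0 < π b) (hbk : π b ≤ k) (hc : k < π c) :
    ¬ GridLesserSimplyPaired T := by
  have hmono : ∀ v w, v ≤ w → π v ≤ π w := fun v w h => by
    have := hπ v w
    rw [inf_eq_left.mpr h] at this
    omega
  intro h
  let T' : Fin (r+1) × Fin (s+1) → Fin (r+1) × Fin (s+1) → Prop :=
    fun v w => v ≤ w ∧ ((π v ≤ k ↔ π w ≤ k) ∨ π v = 0)
  let S : Fin (r+1) × Fin (s+1) → Fin (r+1) × Fin (s+1) → Prop :=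
    fun v w => v ≤ w ∧ (π v ≤ k ↔ π w ≤ k)
  have hTS : ∀ v w, T v w → S v w := fun v w hvw => ⟨hT.1 v w hvw, hside v w hvw⟩
  have hTT' : ∀ v w, T v w → T' v w := fun v w hvw =>
    ⟨hT.1 v w hvw, Or.inl (hside v w hvw)⟩
  have hT' : IsGridTransferSystem T' := by
    refine ⟨fun v w h => h.1, fun v => ⟨le_rfl, Or.inl Iff.rfl⟩, ?_, ?_⟩
    · rintro u v w ⟨h1, h2⟩ ⟨h3, h4⟩
      have := hmono u v h1
      exact ⟨h1.trans h3, by omega⟩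
    · rintro v w u ⟨h1, h2⟩
      refine ⟨inf_le_inf_right u h1, ?_⟩
      rw [hπ, hπ]
      omega
  have hS : IsGridTransferSystem S := by
    refine ⟨fun v w h => h.1, fun v => ⟨le_rfl, Iff.rfl⟩, ?_, ?_⟩
    · rintro u v w ⟨h1, h2⟩ ⟨h3, h4⟩
      exact ⟨h1.trans h3, h2.trans h4⟩
    · rintro v w u ⟨h1, h2⟩
      refine ⟨inf_le_inf_right u h1, ?_⟩
      rw [hπ, hπ]
      omega
  have hSsat : GridSaturated S := by
    rintro u v w huv hvw ⟨-, h⟩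
    have := hmono u v huv
    have := hmono v w hvw
    exact ⟨hvw, by omega⟩
  have hcompat : GridCompatible T T' := by
    refine ⟨hTT', ?_⟩
    rintro A B C - hCA hTBA ⟨-, h⟩
    have hBA := hside B A hTBA
    have := hmono C A hCA
    rw [hπ] at h
    exact ⟨hCA, by omega⟩
  rcases (h T' hT' hTT').mp hcompat with ⟨-, -, -, hmin⟩ | heq
  · have hac : S a c := hmin S hS hSsat hTS a c ⟨hab.trans hbc, Or.inr ha⟩
    have := hac.2
    omega
  · have hbc' : T' b c := by
      rw [heq]
      exact hbc
    have := hbc'.2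
    omega


/-- If a grid transfer system has exactly two connected components and the component
of `(0,0)` is a thick horizontal rectangle `H_k` (`0 < k < s`) or a thick vertical
rectangle `V_ℓ` (`0 < ℓ < r`), then `T` is not lesser simply paired. -/
theorem thick_rectangle_not_lsp {r s : ℕ}
    (T : Fin (r+1) × Fin (s+1) → Fin (r+1) × Fin (s+1) → Prop)
    (hT : IsGridTransferSystem T) (h2 : GridTwoComponents T)
    (hshape :
      (∃ k : Fin (s+1), 0 < (k : ℕ) ∧ (k : ℕ) < s ∧
        ∀ v, GridSameComponent T (0, 0) v ↔ v.2 ≤ k) ∨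
      (∃ l : Fin (r+1), 0 < (l : ℕ) ∧ (l : ℕ) < r ∧
        ∀ v, GridSameComponent T (0, 0) v ↔ v.1 ≤ l)) :
    ¬ GridLesserSimplyPaired T := by
  have hcomp : ∀ v w, T v w → (GridSameComponent T (0, 0) v ↔ GridSameComponent T (0, 0) w) :=
    fun v w hvw => ⟨fun h => h.tail (Or.inl hvw), fun h => h.tail (Or.inr hvw)⟩
  rcases hshape with ⟨k, hk, hks, hH⟩ | ⟨l, hl, hlr, hV⟩
  · refine not_gridLesserSimplyPaired_of_threshold T hT (fun v => (v.2 : ℕ)) ?_ k ?_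
      (0, 0) (0, k) (0, Fin.last s) ⟨le_rfl, Fin.zero_le k⟩ ⟨le_rfl, Fin.le_last k⟩
      rfl hk le_rfl hks
    · exact fun v w => Fin.coe_min v.2 w.2
    · exact fun v w hvw => by simpa only [hH, Fin.le_def] using hcomp v w hvw
  · refine not_gridLesserSimplyPaired_of_threshold T hT (fun v => (v.1 : ℕ)) ?_ l ?_
      (0, 0) (l, 0) (Fin.last r, 0) ⟨Fin.zero_le l, le_rfl⟩ ⟨Fin.le_last l, le_rfl⟩
      rfl hl le_rfl hlr
    · exact fun v w => Fin.coe_min v.1 w.1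
    · exact fun v w hvw => by simpa only [hV, Fin.le_def] using hcomp v w hvw
end

section
/- Let T be a C_{p^r q^s}-transfer system, modeled on the grid Fin (r+1) × Fin (s+1), with exactly two connected components. If the connected component of (0,0) equals L_{(ℓ,k)} = {(i,j) : i ≤ ℓ or j ≤ k} for some ℓ < r and k < s, then T is not lesser simply paired. -/
/-- The relation on the grid allowing `v ≤ w` unless `v` lies above row `k` and the step from
`v` to `w` crosses column `l`. -/
def GridColumnBarrier {r s : ℕ} (l : Fin (r+1)) (k : Fin (s+1))
    (v w : Fin (r+1) × Fin (s+1)) : Prop :=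
  v ≤ w ∧ (k < v.2 → l < w.1 → l < v.1)

theorem isGridTransferSystem_gridColumnBarrier {r s : ℕ} (l : Fin (r+1)) (k : Fin (s+1)) :
    IsGridTransferSystem (GridColumnBarrier l k) := by
  refine ⟨fun v w h => h.1, fun v => ⟨le_rfl, fun _ h => h⟩, ?_, ?_⟩
  · rintro u v w ⟨huv, h₁⟩ ⟨hvw, h₂⟩
    exact ⟨huv.trans hvw, fun hu hw => h₁ hu (h₂ (hu.trans_le huv.2) hw)⟩
  · rintro v w u ⟨hvw, h⟩
    refine ⟨inf_le_inf_right u hvw, fun hv hw => ?_⟩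
    exact lt_inf_iff.2 ⟨h (lt_inf_iff.1 hv).1 (lt_inf_iff.1 hw).1, (lt_inf_iff.1 hw).2⟩

theorem not_gridSaturated_gridColumnBarrier {r s : ℕ} {l : Fin (r+1)} {k : Fin (s+1)}
    (hl : (l : ℕ) < r) (hk : (k : ℕ) < s) : ¬ GridSaturated (GridColumnBarrier l k) := by
  intro h
  have hl' : l < Fin.last r := hl
  have hk' : k < Fin.last s := hk
  have hbarrier := h (0, 0) (0, Fin.last s) (Fin.last r, Fin.last s)
    ⟨le_rfl, Fin.zero_le _⟩ ⟨Fin.zero_le _, le_rfl⟩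
    ⟨⟨Fin.zero_le _, Fin.zero_le _⟩, fun h0 => absurd h0 (Fin.not_lt_zero _)⟩
  exact Fin.not_lt_zero _ (hbarrier.2 hk' hl')

theorem gridColumnBarrier_ne_le {r s : ℕ} {l : Fin (r+1)} {k : Fin (s+1)}
    (hl : (l : ℕ) < r) (hk : (k : ℕ) < s) :
    GridColumnBarrier l k ≠ fun v w => v ≤ w := by
  intro h
  refine not_gridSaturated_gridColumnBarrier hl hk ?_
  rw [h]
  exact fun u v w _ hvw _ => hvw

theorem gridCompatible_gridColumnBarrier {r s : ℕ}
    {T : Fin (r+1) × Fin (s+1) → Fin (r+1) × Fin (s+1) → Prop}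
    {l : Fin (r+1)} {k : Fin (s+1)} (hT : ∀ v w, T v w → v ≤ w)
    (hcorner : ∀ v w, T v w → l < w.1 → k < w.2 → l < v.1 ∧ k < v.2) :
    GridCompatible T (GridColumnBarrier l k) := by
  refine ⟨fun v w h => ⟨hT v w h, fun hv hw => ?_⟩, ?_⟩
  · exact (hcorner v w h hw (hv.trans_le (hT v w h).2)).1
  · rintro A B C - hCA hBA ⟨-, h⟩
    refine ⟨hCA, fun hC hA => ?_⟩
    have hB := hcorner B A hBA hA (hC.trans_le hCA.2)
    exact (lt_inf_iff.1 (h (lt_inf_iff.2 ⟨hB.2, hC⟩) hB.1)).2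

/-- If a grid transfer system has exactly two connected components and the component
of `(0,0)` is an L-shape `L_{(ℓ,k)}` (`ℓ < r`, `k < s`), then `T` is not lesser
simply paired. -/
theorem l_shape_not_lsp {r s : ℕ}
    (T : Fin (r+1) × Fin (s+1) → Fin (r+1) × Fin (s+1) → Prop)
    (hT : IsGridTransferSystem T) (h2 : GridTwoComponents T)
    (l : Fin (r+1)) (k : Fin (s+1)) (hl : (l : ℕ) < r) (hk : (k : ℕ) < s)
    (hshape : ∀ v, GridSameComponent T (0, 0) v ↔ (v.1 ≤ l ∨ v.2 ≤ k)) :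
    ¬ GridLesserSimplyPaired T := by
  intro hlsp
  have hcorner : ∀ v w, T v w → l < w.1 → k < w.2 → l < v.1 ∧ k < v.2 := by
    intro v w hvw hw₁ hw₂
    by_contra hv
    have hv' : v.1 ≤ l ∨ v.2 ≤ k := by
      rwa [not_and_or, not_lt, not_lt] at hv
    have hw : GridSameComponent T (0, 0) w := ((hshape v).2 hv').tail (Or.inl hvw)
    exact ((hshape w).1 hw).elim hw₁.not_ge hw₂.not_ge
  have hcompat := gridCompatible_gridColumnBarrier hT.1 hcorner
  rcases (hlsp _ (isGridTransferSystem_gridColumnBarrier l k) hcompat.1).1 hcompat with h | h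
  · exact not_gridSaturated_gridColumnBarrier hl hk h.2.1
  · exact gridColumnBarrier_ne_le hl hk h
end

section
/- Let T be a C_{p^n}-transfer system, modeled on the chain Fin (n+1) (the case s = 0 of the grid model). Then T is lesser simply paired if and only if either T is connected (all vertices lie in one connected component), or T has exactly two connected components and the connected component of the vertex 0 is the singleton {0}. -/
/-- A `C_{p^n}`-transfer system, modeled on the chain `Fin (n+1)`. -/
def IsChainTransferSystem {n : ℕ} (T : Fin (n+1) → Fin (n+1) → Prop) : Prop :=
  (∀ i j, T i j → i ≤ j) ∧
  (∀ i, T i i) ∧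
  (∀ i j k, T i j → T j k → T i k) ∧
  (∀ i j m, T i j → T (min i m) (min j m))

/-- Two vertices are in the same connected component of `T`. -/
def ChainSameComponent {n : ℕ} (T : Fin (n+1) → Fin (n+1) → Prop)
    (i j : Fin (n+1)) : Prop :=
  Relation.ReflTransGen (fun x y => T x y ∨ T y x) i j

/-- `(T, T')` is a compatible pair of chain transfer systems. -/
def ChainCompatible {n : ℕ} (T T' : Fin (n+1) → Fin (n+1) → Prop) : Prop :=
  (∀ i j, T i j → T' i j) ∧
  ∀ i j k : Fin (n+1), j ≤ i → k ≤ i → T j i → T' (min j k) j → T' k i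

/-- A chain transfer system is saturated. -/
def ChainSaturated {n : ℕ} (T : Fin (n+1) → Fin (n+1) → Prop) : Prop :=
  ∀ i j k : Fin (n+1), i ≤ j → j ≤ k → T i k → T j k

/-- `Th` is a saturated hull of `T`. -/
def ChainSaturatedHull {n : ℕ} (T Th : Fin (n+1) → Fin (n+1) → Prop) : Prop :=
  IsChainTransferSystem Th ∧ ChainSaturated Th ∧ (∀ i j, T i j → Th i j) ∧
  ∀ T'' : Fin (n+1) → Fin (n+1) → Prop, IsChainTransferSystem T'' → ChainSaturated T'' →
    (∀ i j, T i j → T'' i j) → (∀ i j, Th i j → T'' i j)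

/-- `T` is lesser simply paired. -/
def ChainLesserSimplyPaired {n : ℕ} (T : Fin (n+1) → Fin (n+1) → Prop) : Prop :=
  ∀ T' : Fin (n+1) → Fin (n+1) → Prop,
    IsChainTransferSystem T' → (∀ i j, T i j → T' i j) →
    (ChainCompatible T T' ↔ (ChainSaturatedHull T T' ∨ T' = fun i j => i ≤ j))

section ChainHull

variable {n : ℕ} {T T' : Fin (n+1) → Fin (n+1) → Prop}

theorem ChainSameComponent.symm {i j : Fin (n+1)} (h : ChainSameComponent T i j) :
    ChainSameComponent T j i := by
  have : Std.Symm fun x y => T x y ∨ T y x := ⟨fun _ _ => Or.symm⟩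
  exact Std.Symm.symm (r := Relation.ReflTransGen fun x y => T x y ∨ T y x) _ _ h

theorem ChainSameComponent.trans {i j k : Fin (n+1)} (h : ChainSameComponent T i j)
    (h' : ChainSameComponent T j k) : ChainSameComponent T i k :=
  Relation.ReflTransGen.trans h h'

theorem ChainSameComponent.of_rel {i j : Fin (n+1)} (h : T i j) : ChainSameComponent T i j :=
  Relation.ReflTransGen.single (Or.inl h)

/-- Restriction along an intermediate vertex. -/
theorem IsChainTransferSystem.restrict (hT : IsChainTransferSystem T) {i m j : Fin (n+1)}
    (h : T i j) (him : i ≤ m) (hmj : m ≤ j) : T i m := by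
  have := hT.2.2.2 i j m h
  rwa [min_eq_left him, min_eq_right hmj] at this

/-- Components of a chain transfer system are order-convex. -/
theorem IsChainTransferSystem.sameComponent_of_le (hT : IsChainTransferSystem T)
    {i m j : Fin (n+1)} (h : ChainSameComponent T i j) (him : i ≤ m) (hmj : m ≤ j) :
    ChainSameComponent T i m := by
  induction h generalizing m with
  | refl => exact le_antisymm him hmj ▸ .refl
  | @tail y z hy hyz ih =>
    rcases le_or_gt m y with hm | hm
    · exact ih him hm
    · rcases hyz with hyz | hzy
      · exact ChainSameComponent.trans hy (.of_rel (hT.restrict hyz hm.le hmj))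
      · exact absurd (hmj.trans (hT.1 _ _ hzy)) hm.not_ge

/-- The order relation within the components of `T`; it is the saturated hull of `T`. -/
def chainHull (T : Fin (n+1) → Fin (n+1) → Prop) (i j : Fin (n+1)) : Prop :=
  i ≤ j ∧ ChainSameComponent T i j

theorem IsChainTransferSystem.chainHull_of_rel (hT : IsChainTransferSystem T)
    {i j : Fin (n+1)} (h : T i j) : chainHull T i j :=
  ⟨hT.1 _ _ h, .of_rel h⟩

theorem IsChainTransferSystem.isChainTransferSystem_chainHull (hT : IsChainTransferSystem T) :
    IsChainTransferSystem (chainHull T) := by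
  refine ⟨fun i j h => h.1, fun i => ⟨le_rfl, .refl⟩,
    fun i j k h h' => ⟨h.1.trans h'.1, h.2.trans h'.2⟩,
    fun i j m h => ⟨min_le_min_right m h.1, ?_⟩⟩
  rcases le_total m i with hm | hm
  · rw [min_eq_right hm, min_eq_right (hm.trans h.1)]
    exact .refl
  · rw [min_eq_left hm]
    exact hT.sameComponent_of_le h.2 (le_min h.1 hm) (min_le_left _ _)

theorem IsChainTransferSystem.saturated_chainHull (hT : IsChainTransferSystem T) :
    ChainSaturated (chainHull T) := fun _ _ _ hij hjk h =>
  ⟨hjk, (hT.sameComponent_of_le h.2 hij hjk).symm.trans h.2⟩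

/-- A transfer system containing every `b → c` with `a ≤ b ≤ c` and `T a c` contains the
saturated hull of `T`. -/
theorem IsChainTransferSystem.of_chainHull (hT : IsChainTransferSystem T)
    (hT' : IsChainTransferSystem T') (hmid : ∀ a b c, a ≤ b → b ≤ c → T a c → T' b c)
    {i j : Fin (n+1)} (h : chainHull T i j) : T' i j := by
  suffices H : ∀ z, ChainSameComponent T i z → ∀ m, i ≤ m → m ≤ z → T' i m from
    H j h.2 j h.1 le_rfl
  intro z hz
  induction hz with
  | refl => exact fun m him hmi => le_antisymm him hmi ▸ hT'.2.1 _
  | @tail y z _ hyz ih =>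
    intro m him hmz
    rcases le_or_gt m y with hm | hm
    · exact ih m him hm
    · rcases hyz with hyz | hzy
      · have hym := hT.restrict hyz hm.le hmz
        rcases le_total i y with hiy | hyi
        · exact hT'.2.2.1 _ _ _ (ih y hiy le_rfl) (hmid _ _ _ le_rfl hm.le hym)
        · exact hmid _ _ _ hyi him hym
      · exact absurd (hmz.trans (hT.1 _ _ hzy)) hm.not_ge

theorem IsChainTransferSystem.chainCompatible_iff (hT : IsChainTransferSystem T)
    (hT' : IsChainTransferSystem T') :
    ChainCompatible T T' ↔ ∀ i j, chainHull T i j → T' i j := by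
  refine ⟨fun h i j => hT.of_chainHull hT' fun a b c hab hbc hac =>
    h.2 c a b (hab.trans hbc) hbc hac (by rw [min_eq_left hab]; exact hT'.2.1 a), fun h => ?_⟩
  have hsub : ∀ i j, T i j → T' i j := fun i j hij => h _ _ (hT.chainHull_of_rel hij)
  refine ⟨hsub, fun i j k _ hki hji hkj => ?_⟩
  rcases le_total j k with hjk | hjk
  · exact h _ _ (hT.saturated_chainHull _ _ _ hjk hki (hT.chainHull_of_rel hji))
  · exact hT'.2.2.1 _ _ _ (min_eq_right hjk ▸ hkj) (hsub _ _ hji)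

theorem IsChainTransferSystem.chainSaturatedHull_chainHull (hT : IsChainTransferSystem T) :
    ChainSaturatedHull T (chainHull T) :=
  ⟨hT.isChainTransferSystem_chainHull, hT.saturated_chainHull, fun _ _ => hT.chainHull_of_rel,
    fun _ hT'' hsat hsub _ _ => hT.of_chainHull hT'' fun a b c hab hbc hac =>
      hsat a b c hab hbc (hsub _ _ hac)⟩

theorem IsChainTransferSystem.chainSaturatedHull_iff (hT : IsChainTransferSystem T) :
    ChainSaturatedHull T T' ↔ T' = chainHull T := by
  refine ⟨fun h => ?_, fun h => h ▸ hT.chainSaturatedHull_chainHull⟩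
  have hH := hT.chainSaturatedHull_chainHull
  ext i j
  exact ⟨h.2.2.2 _ hH.1 hH.2.1 hH.2.2.1 i j, hH.2.2.2 _ h.1 h.2.1 h.2.2.1 i j⟩

/-- `T` is lesser simply paired iff its saturated hull is complete or a coatom among
transfer systems. -/
theorem IsChainTransferSystem.chainLesserSimplyPaired_iff (hT : IsChainTransferSystem T) :
    ChainLesserSimplyPaired T ↔ ∀ T', IsChainTransferSystem T' →
      (∀ i j, chainHull T i j → T' i j) →
      T' = chainHull T ∨ T' = fun i j => i ≤ j := by
  constructor
  · intro h T' hT' hsub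
    rw [← hT.chainSaturatedHull_iff]
    exact (h T' hT' fun i j hij => hsub _ _ (hT.chainHull_of_rel hij)).1
      ((hT.chainCompatible_iff hT').2 hsub)
  · intro h T' hT' _
    rw [hT.chainCompatible_iff hT', hT.chainSaturatedHull_iff]
    refine ⟨h T' hT', ?_⟩
    rintro (rfl | rfl)
    · exact fun _ _ => id
    · exact fun _ _ hij => hij.1

/-- Adding all transfers out of `0` to a transfer system gives a transfer system. -/
theorem IsChainTransferSystem.or_eq_zero (hT : IsChainTransferSystem T) :
    IsChainTransferSystem fun i j => T i j ∨ i = 0 := by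
  refine ⟨?_, fun i => Or.inl (hT.2.1 i), ?_, ?_⟩
  · rintro i j (h | rfl)
    · exact hT.1 _ _ h
    · exact Fin.zero_le j
  · rintro i j k (h | rfl) h'
    · rcases h' with h' | rfl
      · exact Or.inl (hT.2.2.1 _ _ _ h h')
      · exact Or.inr (Fin.le_zero_iff.1 (hT.1 _ _ h))
    · exact Or.inr rfl
  · rintro i j m (h | rfl)
    · exact Or.inl (hT.2.2.2 _ _ _ h)
    · exact Or.inr (min_eq_left (Fin.zero_le m))

end ChainHull


/-- A `C_{p^n}`-transfer system is lesser simply paired iff it is connected, or it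
has exactly two connected components and the component of `0` is the singleton
`{0}`. -/
theorem chain_lsp_iff {n : ℕ} (T : Fin (n+1) → Fin (n+1) → Prop)
    (hT : IsChainTransferSystem T) :
    ChainLesserSimplyPaired T ↔
      ((∀ i j : Fin (n+1), ChainSameComponent T i j) ∨
       ((¬ ChainSameComponent T 0 (Fin.last n) ∧
         ∀ i, ChainSameComponent T 0 i ∨ ChainSameComponent T (Fin.last n) i) ∧
        (∀ i, ChainSameComponent T 0 i ↔ i = 0))) := by
  rw [hT.chainLesserSimplyPaired_iff]
  constructor
  · intro h
    by_cases hlast : ChainSameComponent T 0 (Fin.last n)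
    · have h0 (i : Fin (n+1)) : ChainSameComponent T 0 i :=
        hT.sameComponent_of_le hlast (Fin.zero_le i) (Fin.le_last i)
      exact Or.inl fun i j => (h0 i).symm.trans (h0 j)
    right
    have hpos (i : Fin (n+1)) (hi : i ≠ 0) : ChainSameComponent T i (Fin.last n) := by
      rcases h _ hT.isChainTransferSystem_chainHull.or_eq_zero fun i j hij => Or.inl hij with heq | heq
      · have h0 := congrFun (congrFun heq 0) (Fin.last n)
        exact absurd (h0.mp (Or.inr rfl)).2 hlast
      · have hi' := congrFun (congrFun heq i) (Fin.last n)
        exact ((hi'.mpr (Fin.le_last i)).resolve_right hi).2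
    refine ⟨⟨hlast, fun i => ?_⟩, fun i => ⟨fun hi => ?_, fun hi => hi ▸ .refl⟩⟩
    · rcases eq_or_ne i 0 with rfl | hi
      · exact Or.inl .refl
      · exact Or.inr (hpos i hi).symm
    · by_contra hne
      exact hlast (hi.trans (hpos i hne))
  · rintro (hconn | ⟨⟨-, hcov⟩, h0⟩) T' hT' hsub
    · right
      ext i j
      exact ⟨hT'.1 i j, fun hij => hsub _ _ ⟨hij, hconn i j⟩⟩
    · by_cases hle : ∀ i j, T' i j → chainHull T i j
      · left
        ext i j
        exact ⟨hle i j, hsub i j⟩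
      right
      have hpos (i j : Fin (n+1)) (hij : i ≤ j) (hi : i ≠ 0) : chainHull T i j := by
        have hj : j ≠ 0 := fun hj => hi (Fin.le_zero_iff.1 (hj ▸ hij))
        exact ⟨hij, ((hcov i).resolve_left (mt (h0 i).1 hi)).symm.trans
          ((hcov j).resolve_left (mt (h0 j).1 hj))⟩
      push Not at hle
      obtain ⟨a, b, hab, hnab⟩ := hle
      obtain rfl : a = 0 := by
        by_contra ha
        exact hnab (hpos a b (hT'.1 _ _ hab) ha)
      have hb : b ≠ 0 := by
        rintro rfl
        exact hnab ⟨le_rfl, .refl⟩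
      ext i j
      refine ⟨hT'.1 i j, fun hij => ?_⟩
      rcases eq_or_ne i 0 with rfl | hi
      · rcases le_total j b with hjb | hbj
        · exact hT'.restrict hab hij hjb
        · exact hT'.2.2.1 _ _ _ hab (hsub _ _ (hpos b j hbj hb))
      · exact hsub _ _ (hpos i j hij hi)
end
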